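/- arXiv:2211.02021 — 2 statements merged into one kernel-verified Lean document; each statement's English description precedes it below -/
import Mathlib

section
/- Let n ≥ 1 and let ρ be an alignment-free 2-uniform sock ordering of length 2n with associated permutation σ_ρ ∈ S_n. Then ρ is foot-sortable if and only if one of the following holds: (i) σ_ρ(1) < n and the sequence σ_ρ(2) σ_ρ(3) ⋯ σ_ρ(n) avoids the permutation patterns 123, 132, and 213; or (ii) σ_ρ(1) = n and the sequence σ_ρ(3) σ_ρ(4) ⋯ σ_ρ(n) avoids the permutation patterns 123, 132, and 213. -/
/-- Two words represent the same sock ordering iff they have the same length and the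
same pattern of letter equalities. -/
def SockEquiv (w v : List ℕ) : Prop :=
  w.length = v.length ∧ ∀ i j, i < w.length → j < w.length →
    (w.getD i 0 = w.getD j 0 ↔ v.getD i 0 = v.getD j 0)

theorem sockEquiv_refl (w : List ℕ) : SockEquiv w w :=
  ⟨rfl, fun _ _ _ _ => Iff.rfl⟩

theorem sockEquiv_symm {w v : List ℕ} (h : SockEquiv w v) : SockEquiv v w := by
  obtain ⟨hl, he⟩ := h
  exact ⟨hl.symm, fun i j hi hj => (he i j (by omega) (by omega)).symm⟩

theorem sockEquiv_trans {u v w : List ℕ} (h1 : SockEquiv u v) (h2 : SockEquiv v w) :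
    SockEquiv u w := by
  obtain ⟨hl1, he1⟩ := h1
  obtain ⟨hl2, he2⟩ := h2
  exact ⟨hl1.trans hl2, fun i j hi hj =>
    (he1 i j hi hj).trans (he2 i j (by omega) (by omega))⟩

instance sockSetoid : Setoid (List ℕ) :=
  ⟨SockEquiv, ⟨sockEquiv_refl, sockEquiv_symm, sockEquiv_trans⟩⟩

/-- A sock ordering is an equivalence class of words. -/
def SockOrdering : Type := Quotient sockSetoid

/-- The length of a sock ordering. -/
def SockOrdering.length : SockOrdering → ℕ :=
  Quotient.lift List.length fun _ _ h => h.1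

/-- One step of the (nondeterministic) one-stack (one-foot) sorting procedure, acting on
(input, stack, output) triples: push the leftmost input letter onto the stack, or pop
the top letter of the stack onto the right end of the output. -/
inductive StackStep : List ℕ × List ℕ × List ℕ → List ℕ × List ℕ × List ℕ → Prop
  | push (a : ℕ) (inp st out : List ℕ) :
      StackStep (a :: inp, st, out) (inp, a :: st, out)
  | pop (a : ℕ) (inp st out : List ℕ) :
      StackStep (inp, a :: st, out) (inp, st, out ++ [a])

/-- `out` is obtainable from `w` by one pass through a stack. -/
def IsStackOutput (w out : List ℕ) : Prop :=
  Relation.ReflTransGen StackStep (w, [], []) ([], [], out)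

/-- A word has all equal letters consecutive, i.e. it represents a sorted sock ordering. -/
def SortedWordSock (w : List ℕ) : Prop :=
  ∀ i j k, i < j → j < k → k < w.length →
    w.getD i 0 = w.getD k 0 → w.getD i 0 = w.getD j 0

/-- A sock ordering is sorted if some (equivalently, every) word representing it has all
equal letters consecutive. -/
def SockOrdering.IsSorted (ρ : SockOrdering) : Prop :=
  ∃ w : List ℕ, (⟦w⟧ : SockOrdering) = ρ ∧ SortedWordSock w

/-- `foot ρ` is the set of sock orderings represented by the outputs obtainable by
one pass of foot-sorting applied to a word representing `ρ`. -/
def foot (ρ : SockOrdering) : Set SockOrdering :=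
  {κ | ∃ w out : List ℕ, (⟦w⟧ : SockOrdering) = ρ ∧ IsStackOutput w out ∧
    (⟦out⟧ : SockOrdering) = κ}

/-- Iterated foot-sorting: `footIter 0 ρ = {ρ}` and
`footIter (t+1) ρ = ⋃ κ ∈ footIter t ρ, foot κ`. -/
def footIter : ℕ → SockOrdering → Set SockOrdering
  | 0, ρ => {ρ}
  | t + 1, ρ => ⋃ κ ∈ footIter t ρ, foot κ

/-- A sock ordering is `t`-foot-sortable if `foot^t ρ` contains a sorted sock ordering. -/
def FootSortable (t : ℕ) (ρ : SockOrdering) : Prop :=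
  ∃ κ ∈ footIter t ρ, κ.IsSorted

/-- `ρ` has exactly `n` colors. -/
def HasColors (ρ : SockOrdering) (n : ℕ) : Prop :=
  ∃ w : List ℕ, (⟦w⟧ : SockOrdering) = ρ ∧ w.toFinset.card = n

/-- `ρ` is `r`-uniform: every color appears exactly `r` times. -/
def RUniform (r : ℕ) (ρ : SockOrdering) : Prop :=
  ∃ w : List ℕ, (⟦w⟧ : SockOrdering) = ρ ∧ ∀ a ∈ w, w.count a = r

/-- `ρ` contains `ρ'` as a (sock) pattern: some word representing `ρ` has a subsequence
representing `ρ'`. -/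
def Contains (ρ ρ' : SockOrdering) : Prop :=
  ∃ w u : List ℕ, (⟦w⟧ : SockOrdering) = ρ ∧ u.Sublist w ∧ (⟦u⟧ : SockOrdering) = ρ'

/-- A word is stratified with `n` colors and `r` blocks: it is the concatenation of `r`
blocks of length `n`, each containing every color exactly once. -/
def StratifiedWord (n r : ℕ) (w : List ℕ) : Prop :=
  ∃ blocks : List (List ℕ), blocks.length = r ∧ w = blocks.flatten ∧
    ∀ b ∈ blocks, b.length = n ∧ b.Nodup ∧ b.toFinset = w.toFinset

/-- An `r`-uniform stratified sock ordering with `n` colors. -/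
def IsStratified (n r : ℕ) (ρ : SockOrdering) : Prop :=
  ∃ w : List ℕ, (⟦w⟧ : SockOrdering) = ρ ∧ StratifiedWord n r w

/-- The word `σ(1) σ(2) ⋯ σ(n)` (with values written in `{1,…,n}`). -/
def permWord (n : ℕ) (σ : Equiv.Perm (Fin n)) : List ℕ :=
  (List.finRange n).map fun i => (σ i : ℕ) + 1

/-- The word `1 2 ⋯ n σ(1) σ(2) ⋯ σ(n)` representing the alignment-free 2-uniform sock
ordering associated with `σ`. -/
def afWord (n : ℕ) (σ : Equiv.Perm (Fin n)) : List ℕ :=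
  ((List.finRange n).map fun i => (i : ℕ) + 1) ++ permWord n σ

/-- A word `w` contains the (permutation) pattern `p`: some subsequence of `w` of the same
length as `p` is order-isomorphic to `p`. -/
def ContainsPattern (w p : List ℕ) : Prop :=
  ∃ s : List ℕ, s.Sublist w ∧ s.length = p.length ∧
    ∀ i j, i < s.length → j < s.length →
      (s.getD i 0 < s.getD j 0 ↔ p.getD i 0 < p.getD j 0)

def AvoidsPattern (w p : List ℕ) : Prop := ¬ ContainsPattern w p

/-- A word avoids the permutation patterns 123, 132, and 213. -/
def Avoids123_132_213 (w : List ℕ) : Prop :=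
  AvoidsPattern w [1, 2, 3] ∧ AvoidsPattern w [1, 3, 2] ∧ AvoidsPattern w [2, 1, 3]

/-- A word avoids the pattern 231: there are no indices `i < j < k` with `w k < w i < w j`. -/
def Avoids231 (w : List ℕ) : Prop :=
  ¬ ∃ i j k, i < j ∧ j < k ∧ k < w.length ∧
    w.getD k 0 < w.getD i 0 ∧ w.getD i 0 < w.getD j 0

/-- `StackRun w S o`: with remaining input `w` and stack `S` (top first), the remaining
output can be `o`. -/
inductive StackRun : List ℕ → List ℕ → List ℕ → Prop
  | nil : StackRun [] [] []
  | push {a : ℕ} {w S o : List ℕ} : StackRun w (a :: S) o → StackRun (a :: w) S o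
  | pop {a : ℕ} {w S o : List ℕ} : StackRun w S o → StackRun w (a :: S) (a :: o)

theorem StackRun.reflTransGen {w S o : List ℕ} (h : StackRun w S o) (out : List ℕ) :
    Relation.ReflTransGen StackStep (w, S, out) ([], [], out ++ o) := by
  induction h generalizing out with
  | nil => simpa using Relation.ReflTransGen.refl
  | push _ ih => exact Relation.ReflTransGen.head (StackStep.push _ _ _ _) (ih out)
  | @pop a w S o _ ih =>
    have := Relation.ReflTransGen.head (StackStep.pop a w S out) (ih (out ++ [a]))
    simpa using this

theorem exists_stackRun_of_reflTransGen {s : List ℕ × List ℕ × List ℕ} {out : List ℕ}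
    (h : Relation.ReflTransGen StackStep s ([], [], out)) :
    ∃ o, out = s.2.2 ++ o ∧ StackRun s.1 s.2.1 o := by
  induction h using Relation.ReflTransGen.head_induction_on with
  | refl => exact ⟨[], by simp, StackRun.nil⟩
  | head hstep _ ih =>
    obtain ⟨o, ho, hr⟩ := ih
    cases hstep with
    | push a inp st out' => exact ⟨o, ho, hr.push⟩
    | pop a inp st out' => exact ⟨a :: o, by simpa using ho, hr.pop⟩

theorem isStackOutput_iff_stackRun {w out : List ℕ} :
    IsStackOutput w out ↔ StackRun w [] out := by
  constructor
  · intro h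
    obtain ⟨o, ho, hr⟩ := exists_stackRun_of_reflTransGen h
    simp only [List.nil_append] at ho
    exact ho ▸ hr
  · intro h
    have := h.reflTransGen []
    rwa [List.nil_append] at this

theorem StackRun.perm {w S o : List ℕ} (h : StackRun w S o) : o.Perm (w ++ S) := by
  induction h with
  | nil => simp
  | push _ ih => exact ih.trans (by simp)
  | pop _ ih => exact (ih.cons _).trans List.perm_middle.symm

theorem StackRun.stack_sublist {w S o : List ℕ} (h : StackRun w S o) : S.Sublist o := by
  induction h with
  | nil => simp
  | push _ ih => exact (List.sublist_cons_self _ _).trans ih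
  | pop _ ih => exact ih.cons_cons _

theorem StackRun.map {w S o : List ℕ} (f : ℕ → ℕ) (h : StackRun w S o) :
    StackRun (w.map f) (S.map f) (o.map f) := by
  induction h with
  | nil => exact .nil
  | push _ ih => exact .push ih
  | pop _ ih => exact .pop ih

theorem StackRun.push_append {p w S o : List ℕ} (h : StackRun w (p.reverse ++ S) o) :
    StackRun (p ++ w) S o := by
  induction p generalizing S with
  | nil => simpa using h
  | cons a p ih => exact .push (ih (by simpa using h))

/-- The first output letter is popped after pushing some prefix of the input. -/
theorem StackRun.exists_pushes {w S o : List ℕ} {c : ℕ} (h : StackRun w S (c :: o)) :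
    ∃ p w' S', w = p ++ w' ∧ p.reverse ++ S = c :: S' ∧ StackRun w' S' o := by
  generalize ho : c :: o = o₁ at h
  induction h with
  | nil => simp at ho
  | push _ ih =>
    obtain ⟨p, w', S', rfl, hS, hr⟩ := ih ho
    exact ⟨_ :: p, w', S', rfl, by simpa using hS, hr⟩
  | pop h _ =>
    obtain ⟨rfl, rfl⟩ := List.cons.inj ho
    exact ⟨[], _, _, rfl, rfl, h⟩

/-- If the next output letter is on top of the stack and does not occur in the input, it is
popped at once. -/
theorem StackRun.pop_of_notMem {w S o : List ℕ} {c : ℕ} (h : StackRun w (c :: S) (c :: o))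
    (hc : c ∉ w) : StackRun w S o := by
  obtain ⟨p, w', S', rfl, hS, hr⟩ := h.exists_pushes
  rcases List.eq_nil_or_concat p with rfl | ⟨p, b, rfl⟩
  · simp only [List.reverse_nil, List.nil_append, List.cons.injEq, true_and] at hS
    simpa [hS] using hr
  · simp at hS hc
    grind

/-- If the next output letter does not occur on the stack, the input is read until it
appears. -/
theorem StackRun.exists_pushes_of_notMem {w S o : List ℕ} {c : ℕ} (h : StackRun w S (c :: o))
    (hc : c ∉ S) : ∃ q w', w = q ++ c :: w' ∧ StackRun w' (q.reverse ++ S) o := by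
  obtain ⟨p, w', S', rfl, hS, hr⟩ := h.exists_pushes
  rcases List.eq_nil_or_concat p with rfl | ⟨p, b, rfl⟩
  · simp at hS
    simp [hS] at hc
  · simp at hS
    obtain ⟨rfl, rfl⟩ := hS
    exact ⟨p, w', by simp, hr⟩

/-- Words of the form `a a b b c c ⋯`. -/
inductive PairedWord : List ℕ → Prop
  | nil : PairedWord []
  | cons {o : List ℕ} (a : ℕ) : PairedWord o → PairedWord (a :: a :: o)

theorem PairedWord.exists_cons {o : List ℕ} (h : PairedWord o) (hne : o ≠ []) :
    ∃ a o', o = a :: a :: o' ∧ PairedWord o' := by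
  cases h with
  | nil => exact absurd rfl hne
  | cons a h => exact ⟨a, _, rfl, h⟩

theorem SortedWordSock.of_cons {a : ℕ} {o : List ℕ} (h : SortedWordSock (a :: o)) :
    SortedWordSock o := by
  intro i j k hij hjk hk he
  simpa using h (i + 1) (j + 1) (k + 1) (by omega) (by omega) (by simpa using hk)
    (by simpa using he)

theorem SortedWordSock.pairedWord {o : List ℕ} (h : SortedWordSock o)
    (hc : ∀ a ∈ o, o.count a = 2) : PairedWord o := by
  match o with
  | [] => exact .nil
  | [a] => simp at hc
  | a :: b :: o =>
    have hab : a = b := by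
      by_contra hab
      have hmem : a ∈ o := by
        have := hc a (by simp)
        rw [← List.count_pos_iff]
        grind
      obtain ⟨k, hk, hka⟩ := List.mem_iff_getElem.1 hmem
      have := h 0 1 (k + 2) (by omega) (by omega) (by simpa using hk) (by simp [hk, hka])
      simp at this
      exact hab this
    subst hab
    have ha : a ∉ o := by
      have := hc a (by simp)
      rw [← List.count_eq_zero]
      grind
    refine .cons a (SortedWordSock.pairedWord h.of_cons.of_cons fun b hb => ?_)
    have := hc b (by simp [hb])
    grind

theorem PairedWord.sortedWordSock {o : List ℕ} (h : PairedWord o)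
    (hc : ∀ a, o.count a ≤ 2) : SortedWordSock o := by
  induction h with
  | nil => intro i j k; simp
  | @cons o a h ih =>
    have ha : a ∉ o := by
      have := hc a
      rw [← List.count_eq_zero]
      grind
    have ih' := ih fun b => by have := hc b; grind
    have key : ∀ k < o.length, a ≠ o.getD k 0 := by
      intro k hk he
      apply ha
      rw [he]
      simp [hk]
    intro i j k hij hjk hk he
    obtain ⟨k, rfl⟩ : ∃ k', k = k' + 2 := ⟨k - 2, by omega⟩
    have hk' : k < o.length := by simpa using hk
    match i, j with
    | 0, _ => exact absurd (by simpa using he) (key k hk')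
    | 1, _ => exact absurd (by simpa using he) (key k hk')
    | i + 2, 0 => omega
    | i + 2, 1 => omega
    | i + 2, j + 2 =>
      simpa using ih' i j k (by omega) (by omega) hk' (by simpa using he)

/-- A map identifying two sock-equivalent words. -/
theorem SockEquiv.exists_map {w v : List ℕ} (h : SockEquiv w v) :
    ∃ f : ℕ → ℕ, w.map f = v ∧ ∀ a ∈ w, ∀ b ∈ w, f a = f b → a = b := by
  obtain ⟨hl, he⟩ := h
  have hidx : ∀ a ∈ w, w.idxOf a < w.length ∧ w.getD (w.idxOf a) 0 = a := by
    intro a ha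
    have := List.idxOf_lt_length_of_mem ha
    exact ⟨this, by simp [this]⟩
  refine ⟨fun a => v.getD (w.idxOf a) 0, ?_, ?_⟩
  · apply List.ext_getElem
    · simpa using hl
    · intro i h1 h2
      have hi : i < w.length := by simpa using h1
      have := hidx w[i] (List.getElem_mem hi)
      have := (he (w.idxOf w[i]) i this.1 hi).1 (by rw [this.2]; simp [hi])
      simpa [h2] using this
  · intro a ha b hb hab
    have := (he _ _ (hidx a ha).1 (hidx b hb).1).2 hab
    rwa [(hidx a ha).2, (hidx b hb).2] at this

theorem SortedWordSock.of_sockEquiv {w v : List ℕ} (h : SockEquiv w v)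
    (hw : SortedWordSock w) : SortedWordSock v := by
  obtain ⟨hl, he⟩ := h
  intro i j k hij hjk hk hik
  exact (he i j (by omega) (by omega)).1
    (hw i j k hij hjk (by omega) ((he i k (by omega) (by omega)).2 hik))

theorem SortedWordSock.map {w : List ℕ} {f : ℕ → ℕ} (hw : SortedWordSock w)
    (hf : ∀ a ∈ w, ∀ b ∈ w, f a = f b → a = b) : SortedWordSock (w.map f) := by
  intro i j k hij hjk hk hik
  have hk' : k < w.length := by simpa using hk
  have hi : i < w.length := by omega
  have hj : j < w.length := by omega
  have := hw i j k hij hjk hk' (by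
    simp only [List.getD_eq_getElem?_getD, List.getElem?_map, hi, hk', List.getElem?_eq_getElem,
      Option.map_some, Option.getD_some] at hik ⊢
    exact hf _ (List.getElem_mem _) _ (List.getElem_mem _) hik)
  simp only [List.getD_eq_getElem?_getD, List.getElem?_map, hi, hj, List.getElem?_eq_getElem,
      Option.map_some, Option.getD_some] at this ⊢
  rw [this]

theorem footIter_one (ρ : SockOrdering) : footIter 1 ρ = foot ρ := by
  simp [footIter]

theorem footSortable_one_iff {w : List ℕ} :
    FootSortable 1 (⟦w⟧ : SockOrdering) ↔ ∃ o, StackRun w [] o ∧ SortedWordSock o := by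
  constructor
  · rintro ⟨κ, hκ, u, rfl, hu⟩
    obtain ⟨w', out, hw', hout, ho⟩ := (footIter_one _).subset hκ
    have hw' : SockEquiv w' w := Quotient.exact hw'
    have ho : SockEquiv out u := Quotient.exact ho
    obtain ⟨f, hf, hinj⟩ := hw'.exists_map
    have hr := isStackOutput_iff_stackRun.1 hout
    have hp : out.Perm w' := by simpa using hr.perm
    refine ⟨out.map f, by simpa [hf] using hr.map f, ?_⟩
    exact (hu.of_sockEquiv (sockEquiv_symm ho)).map fun a ha b hb =>
      hinj a (hp.mem_iff.1 ha) b (hp.mem_iff.1 hb)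
  · rintro ⟨o, hr, ho⟩
    refine ⟨⟦o⟧, (footIter_one _).superset ?_, o, rfl, ho⟩
    exact ⟨w, o, rfl, isStackOutput_iff_stackRun.2 hr, rfl⟩

/-- `SwapLayered S Y`: `Y` arises from `S` by exchanging disjoint pairs of adjacent entries. -/
inductive SwapLayered : List ℕ → List ℕ → Prop
  | nil : SwapLayered [] []
  | keep {S Y : List ℕ} (s : ℕ) : SwapLayered S Y → SwapLayered (s :: S) (s :: Y)
  | swap {S Y : List ℕ} (s a : ℕ) :
      SwapLayered S Y → SwapLayered (s :: a :: S) (a :: s :: Y)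

theorem SwapLayered.perm {S Y : List ℕ} (h : SwapLayered S Y) : S.Perm Y := by
  induction h with
  | nil => exact .refl _
  | keep s _ ih => exact ih.cons s
  | swap s a _ ih => exact (List.Perm.swap a s _).trans ((ih.cons s).cons a)

theorem SwapLayered.exists_stackRun {S Y : List ℕ} (h : SwapLayered S Y) :
    ∃ o, StackRun Y S o ∧ PairedWord o := by
  induction h with
  | nil => exact ⟨[], .nil, .nil⟩
  | keep s _ ih =>
    obtain ⟨o, hr, hp⟩ := ih
    exact ⟨s :: s :: o, hr.pop.pop.push, hp.cons s⟩
  | swap s a _ ih =>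
    obtain ⟨o, hr, hp⟩ := ih
    exact ⟨s :: s :: a :: a :: o, hr.pop.pop.pop.push.push.pop, (hp.cons a).cons s⟩

/-- A sock of color `c` was just output, its partner is among the input `Y`, and the other
colors each have one sock on the stack `S` and one in `Y`. -/
theorem StackRun.partner_cases {Y S o : List ℕ} {c : ℕ} (h : StackRun Y S (c :: o))
    (hp : PairedWord o) (hY : Y.Perm (c :: S)) (hnd : (c :: S).Nodup) :
    (∃ Y', Y = c :: Y' ∧ StackRun Y' S o) ∨
      ∃ a S' Y' o', Y = a :: c :: Y' ∧ S = a :: S' ∧ o = a :: a :: o' ∧ StackRun Y' S' o' := by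
  have hcS : c ∉ S := (List.nodup_cons.1 hnd).1
  have hS : S.Nodup := (List.nodup_cons.1 hnd).2
  obtain ⟨q, Y', rfl, hr⟩ := h.exists_pushes_of_notMem hcS
  have hY2 : (q ++ Y').Perm S := (List.perm_middle.symm.trans hY).cons_inv
  rcases List.eq_nil_or_concat q with rfl | ⟨r, a, rfl⟩
  · exact .inl ⟨Y', rfl, by simpa using hr⟩
  right
  have hoS : o.Perm (S ++ S) := by
    refine hr.perm.trans ?_
    refine List.Perm.trans ?_ (hY2.append_right S)
    rw [← List.append_assoc]
    refine List.Perm.append_right S ?_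
    exact List.perm_append_comm.trans ((List.reverse_perm _).append_right _)
  have haS : a ∈ S := hY2.mem_iff.1 (by simp)
  have hone : o ≠ [] := by
    rintro rfl
    have := hoS.mem_iff.2 (List.mem_append_left S haS)
    simp at this
  obtain ⟨b, o', rfl, hp'⟩ := hp.exists_cons hone
  have hcount : ∀ x, (b :: b :: o').count x = S.count x + S.count x := fun x => by
    rw [hoS.count_eq, List.count_append]
  have hbo : b ∉ o' := by
    have h1 := hcount b
    have h2 : S.count b ≤ 1 := List.nodup_iff_count_le_one.1 hS b
    rw [← List.count_eq_zero]
    simp at h1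
    omega
  have hbS : b ∈ S := by
    have := hoS.mem_iff.1 (List.mem_cons_self)
    simpa using this
  have hsub := hr.stack_sublist
  have hqnd : (r ++ [a] ++ Y').Nodup := by simpa using (hY2.nodup_iff.2 hS)
  have hSo : ∀ T : List ℕ, (T ++ S).Sublist o' → False := fun T hT =>
    hbo (hT.subset (List.mem_append_right T hbS))
  simp only [List.concat_eq_append, List.reverse_append, List.reverse_cons, List.reverse_nil,
    List.nil_append, List.cons_append] at hsub hr
  have hba : b = a := by
    by_contra hba
    have h1 : (a :: (r.reverse ++ S)).Sublist o' := by
      rcases List.sublist_cons_iff.1 hsub with h | ⟨_, h, _⟩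
      · rcases List.sublist_cons_iff.1 h with h | ⟨_, h, _⟩
        · exact h
        · exact absurd (List.cons.inj h).1.symm hba
      · exact absurd (List.cons.inj h).1.symm hba
    exact hSo (a :: r.reverse) h1
  subst hba
  have hsub2 : (r.reverse ++ S).Sublist (b :: o') := List.cons_sublist_cons.1 hsub
  have hr0 : r = [] := by
    rcases List.eq_nil_or_concat r with rfl | ⟨r', d, rfl⟩
    · rfl
    exfalso
    simp only [List.concat_eq_append, List.reverse_append, List.reverse_cons, List.reverse_nil,
      List.nil_append, List.cons_append] at hsub2
    rcases List.sublist_cons_iff.1 hsub2 with h | ⟨_, h, h'⟩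
    · exact hSo (d :: r'.reverse) h
    · have hd := (List.cons.inj h).1
      subst hd
      simp [List.nodup_append] at hqnd
  subst hr0
  simp only [List.reverse_nil, List.nil_append] at hsub2 hr
  obtain ⟨S', rfl⟩ : ∃ S', S = b :: S' := by
    rcases List.sublist_cons_iff.1 hsub2 with h | ⟨S', h, _⟩
    · exact (hSo [] h).elim
    · exact ⟨S', h⟩
  have hbY : b ∉ Y' := by
    simp at hqnd
    exact hqnd.1
  exact ⟨b, S', Y', o', by simp, rfl, rfl, (hr.pop_of_notMem hbY).pop_of_notMem hbY⟩

theorem StackRun.swapLayered {S Y o : List ℕ} (h : StackRun Y S o) (hp : PairedWord o)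
    (hY : Y.Perm S) (hnd : S.Nodup) : SwapLayered S Y := by
  match S with
  | [] =>
    rw [hY.eq_nil]
    exact .nil
  | s :: S =>
    obtain ⟨c, o', rfl, hp'⟩ := hp.exists_cons (by
      rintro rfl
      have := h.stack_sublist
      simp at this)
    have hsS : s ∉ S := (List.nodup_cons.1 hnd).1
    have hS : S.Nodup := (List.nodup_cons.1 hnd).2
    have hYnd : Y.Nodup := hY.nodup_iff.2 hnd
    have hcount : (c :: c :: o').count c = Y.count c + (s :: S).count c := by
      rw [h.perm.count_eq, List.count_append]
    have hco : c ∉ o' := by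
      have h1 : Y.count c ≤ 1 := List.nodup_iff_count_le_one.1 hYnd c
      have h2 : (s :: S).count c ≤ 1 := List.nodup_iff_count_le_one.1 hnd c
      rw [← List.count_eq_zero]
      simp only [List.count_cons_self] at hcount
      omega
    have hcS : c ∈ s :: S := by
      have := h.perm.mem_iff.1 (List.mem_cons_self)
      rcases List.mem_append.1 this with h | h
      · exact hY.mem_iff.1 h
      · exact h
    have hcs : c = s := by
      by_contra hcs
      have hsub : (s :: S).Sublist o' := by
        rcases List.sublist_cons_iff.1 h.stack_sublist with h | ⟨_, h, _⟩
        · rcases List.sublist_cons_iff.1 h with h | ⟨_, h, _⟩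
          · exact h
          · exact absurd (List.cons.inj h).1.symm hcs
        · exact absurd (List.cons.inj h).1.symm hcs
      exact hco (hsub.subset hcS)
    subst hcs
    obtain ⟨p, Y', T, rfl, hT, hr⟩ := h.exists_pushes
    rcases List.eq_nil_or_concat p with rfl | ⟨p, b, rfl⟩
    · simp only [List.reverse_nil, List.nil_append, List.cons.injEq, true_and] at hT hY
      subst hT
      rcases hr.partner_cases hp' hY hnd with ⟨Y, rfl, hr'⟩ | ⟨a, S', Y, o, rfl, rfl, rfl, hr'⟩
      · exact .keep c (hr'.swapLayered hp' hY.cons_inv hS)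
      · refine .swap c a (hr'.swapLayered ?_ ?_ (List.nodup_cons.1 hS).2)
        · cases hp'; assumption
        · exact ((List.Perm.swap a c Y).trans hY).cons_inv.cons_inv
    · simp only [List.concat_eq_append, List.reverse_append, List.reverse_cons, List.reverse_nil,
        List.nil_append, List.cons_append, List.cons.injEq] at hT
      obtain ⟨rfl, rfl⟩ := hT
      have hb : b ∉ p ∧ b ∉ Y' := by
        simp [List.nodup_append] at hYnd
        grind
      obtain ⟨q, Y₂, T, rfl, hT, hr₂⟩ := hr.exists_pushes
      have hqp : q.reverse ++ p.reverse = [] := by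
        by_contra hne
        obtain ⟨d, l, hd⟩ := List.exists_cons_of_ne_nil hne
        have hdm : d ∈ q.reverse ++ p.reverse := by simp [hd]
        rw [← List.append_assoc, hd] at hT
        have := (List.cons.inj hT).1
        subst this
        simp at hdm hb
        grind
      obtain ⟨hq, hp0⟩ := List.append_eq_nil_iff.1 hqp
      rw [List.reverse_eq_nil_iff] at hq hp0
      subst hq hp0
      simp only [List.reverse_nil, List.nil_append, List.cons.injEq, true_and] at hT
      subst hT
      exact .keep b (hr₂.swapLayered hp' (by simpa using hY) hS)
  termination_by S.length

/-- Either the whole block `X` is read before the first output, or the first output letter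
is popped before `X` is exhausted. -/
theorem StackRun.append_cases {X Y S o : List ℕ} {c : ℕ} (h : StackRun (X ++ Y) S (c :: o)) :
    StackRun Y (X.reverse ++ S) (c :: o) ∨
      ∃ X₁ X₂ S', X = X₁ ++ X₂ ∧ X₁.reverse ++ S = c :: S' ∧ StackRun (X₂ ++ Y) S' o := by
  induction X generalizing S with
  | nil => exact .inl h
  | cons x X ih =>
    cases h with
    | push h =>
      rcases ih h with h | ⟨X₁, X₂, S', rfl, hS, hr⟩
      · exact .inl (by simpa using h)
      · exact .inr ⟨x :: X₁, X₂, S', rfl, by simpa using hS, hr⟩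
    | pop h => exact .inr ⟨[], x :: X, _, rfl, rfl, h⟩

theorem exists_stackRun_append_iff {X Y : List ℕ} (hX : X.Nodup) (hY : Y.Perm X) :
    (∃ o, StackRun (X ++ Y) [] o ∧ PairedWord o) ↔
      SwapLayered X.reverse Y ∨ ∃ A c B, X.reverse = A ++ c :: B ∧
        ((∃ Y', Y = c :: Y' ∧ SwapLayered (A ++ B) Y') ∨
          ∃ a S Y', Y = a :: c :: Y' ∧ A ++ B = a :: S ∧ SwapLayered S Y') := by
  have hYr : Y.Perm X.reverse := hY.trans (List.reverse_perm X).symm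
  have hXr : X.reverse.Nodup := List.nodup_reverse.2 hX
  constructor
  · rintro ⟨o, hr, hp⟩
    by_cases hone : o = []
    · subst hone
      have := hr.perm.symm.eq_nil
      simp at this
      obtain ⟨rfl, rfl⟩ := this
      exact .inl .nil
    obtain ⟨c, o, rfl, hp'⟩ := hp.exists_cons hone
    rcases hr.append_cases with hr | ⟨X₁, X₂, S, rfl, hS, hr⟩
    · exact .inl (StackRun.swapLayered (by simpa using hr) hp hYr hXr)
    rw [List.append_nil] at hS
    have hXe : (X₁ ++ X₂).reverse = X₂.reverse ++ c :: S := by simp [hS]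
    rw [hXe] at hYr hXr
    have hYr' := hYr.trans List.perm_middle
    have hnd := List.perm_middle.nodup_iff.1 hXr
    have hcn := (List.nodup_cons.1 hnd).1
    have hr : StackRun Y (X₂.reverse ++ S) (c :: o) := by
      rcases hr.append_cases with hr | ⟨X₃, X₄, S', rfl, hS', _⟩
      · exact hr
      · have : c ∈ X₃.reverse ++ S := by simp [hS']
        simp at this hcn
        grind
    refine .inr ⟨X₂.reverse, c, S, hXe, ?_⟩
    rcases hr.partner_cases hp' hYr' hnd with ⟨Y, rfl, hr'⟩ | ⟨a, S', Y, o, rfl, hS', rfl, hr'⟩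
    · exact .inl ⟨Y, rfl, hr'.swapLayered hp' hYr'.cons_inv (List.nodup_cons.1 hnd).2⟩
    · refine .inr ⟨a, S', Y, rfl, hS', ?_⟩
      rw [hS'] at hYr' hnd
      refine hr'.swapLayered ?_ ?_ (List.nodup_cons.1 (List.nodup_cons.1 hnd).2).2
      · cases hp'; assumption
      · exact ((List.Perm.swap a c Y).trans hYr').cons_inv.cons_inv
  · rintro (h | ⟨A, c, B, hX', h⟩)
    · obtain ⟨o, hr, hp⟩ := h.exists_stackRun
      exact ⟨o, StackRun.push_append (by simpa using hr), hp⟩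
    · have hXe : X = B.reverse ++ c :: A.reverse := by
        rw [← List.reverse_reverse X, hX']
        simp
      have key : ∀ o, StackRun Y (A ++ B) o → StackRun (X ++ Y) [] (c :: o) := by
        intro o ho
        rw [hXe, List.append_assoc]
        refine StackRun.push_append ?_
        simp only [List.reverse_reverse, List.append_nil, List.cons_append]
        exact .push (.pop (StackRun.push_append (by simpa using ho)))
      rcases h with ⟨Y, rfl, h⟩ | ⟨a, S, Y, rfl, hS, h⟩
      · obtain ⟨o, hr, hp⟩ := h.exists_stackRun
        exact ⟨_, key _ hr.pop.push, hp.cons c⟩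
      · obtain ⟨o, hr, hp⟩ := h.exists_stackRun
        refine ⟨c :: c :: a :: a :: o, key _ ?_, (hp.cons a).cons c⟩
        rw [hS]
        exact hr.pop.pop.pop.push.push

/-- Every entry exceeds all entries at least two places to its right. -/
def GapDecreasing (Y : List ℕ) : Prop :=
  ∀ i k, i + 2 ≤ k → k < Y.length → Y.getD k 0 < Y.getD i 0

theorem gapDecreasing_of_length_le {Y : List ℕ} (h : Y.length ≤ 2) : GapDecreasing Y := by
  intro i k hik hk
  omega

theorem gapDecreasing_cons {y : ℕ} {Y : List ℕ} :
    GapDecreasing (y :: Y) ↔ (∀ z ∈ Y.drop 1, z < y) ∧ GapDecreasing Y := by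
  constructor
  · refine fun h => ⟨fun z hz => ?_, fun i k hik hk => ?_⟩
    · obtain ⟨k, hk, rfl⟩ := List.mem_iff_getElem.1 hz
      have hk' : 1 + k < Y.length := by simp at hk; omega
      have := h 0 (1 + k + 1) (by omega) (by simpa using hk')
      simp only [List.getD_cons_succ, List.getD_cons_zero] at this
      rw [List.getD_eq_getElem _ _ hk'] at this
      simpa only [List.getElem_drop] using this
    · simpa using h (i + 1) (k + 1) (by omega) (by simpa using hk)
  · rintro ⟨h1, h2⟩ i k hik hk
    obtain ⟨k, rfl⟩ : ∃ k', k = k' + 2 := ⟨k - 2, by omega⟩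
    match i with
    | 0 =>
      have hk' : k + 1 < Y.length := by simp at hk; omega
      have := h1 (Y[k + 1]) (by
        rw [List.mem_iff_getElem]
        exact ⟨k, by simp; omega, by simp⟩)
      simpa [hk'] using this
    | i + 1 =>
      simpa using h2 i (k + 1) (by omega) (by simp at hk; omega)

theorem avoids_iff_gapDecreasing {Y : List ℕ} (hnd : Y.Nodup) :
    Avoids123_132_213 Y ↔ GapDecreasing Y := by
  constructor
  · rintro ⟨h1, h2, h3⟩ i k hik hk
    by_contra hlt
    have hi : i < Y.length := by omega
    have hj : i + 1 < Y.length := by omega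
    have hsub : [Y[i], Y[i + 1], Y[k]].Sublist Y := by
      have h1 := List.drop_eq_getElem_cons hi
      have h2 := List.drop_eq_getElem_cons hj
      have h3 : Y[k] ∈ Y.drop (i + 1 + 1) := by
        rw [List.mem_iff_getElem]
        exact ⟨k - (i + 1 + 1), by simp; omega, by
          simp only [List.getElem_drop]; congr 1; omega⟩
      refine List.Sublist.trans ?_ (List.drop_sublist i Y)
      rw [h1, h2]
      exact ((List.singleton_sublist.2 h3).cons_cons _).cons_cons _
    have hij : Y[i] ≠ Y[i + 1] := fun h => by
      have := (hnd.getElem_inj_iff).1 h; omega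
    have hjk : Y[i + 1] ≠ Y[k] := fun h => by
      have := (hnd.getElem_inj_iff).1 h; omega
    have hik' : Y[i] ≠ Y[k] := fun h => by
      have := (hnd.getElem_inj_iff).1 h; omega
    simp only [List.getD_eq_getElem?_getD, hi, hk, List.getElem?_eq_getElem,
      Option.getD_some, not_lt] at hlt
    have build : ∀ p : List ℕ, p.length = 3 → ContainsPattern Y p ∨
        ¬ ∀ a b, a < 3 → b < 3 → (([Y[i], Y[i + 1], Y[k]].getD a 0 <
          [Y[i], Y[i + 1], Y[k]].getD b 0) ↔ p.getD a 0 < p.getD b 0) := by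
      intro p hp
      by_cases h : ∀ a b, a < 3 → b < 3 → (([Y[i], Y[i + 1], Y[k]].getD a 0 <
          [Y[i], Y[i + 1], Y[k]].getD b 0) ↔ p.getD a 0 < p.getD b 0)
      · exact .inl ⟨_, hsub, by simp [hp], h⟩
      · exact .inr h
    rcases lt_or_gt_of_ne hij with hij | hij
    · rcases lt_or_gt_of_ne hjk with hjk | hjk
      · refine (build [1, 2, 3] rfl).elim h1 fun h => h ?_
        intro a b ha hb
        interval_cases a <;> interval_cases b <;> simp <;> omega
      · refine (build [1, 3, 2] rfl).elim h2 fun h => h ?_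
        intro a b ha hb
        interval_cases a <;> interval_cases b <;> simp <;> omega
    · refine (build [2, 1, 3] rfl).elim h3 fun h => h ?_
      intro a b ha hb
      interval_cases a <;> interval_cases b <;> simp <;> omega
  · intro h
    have key : ∀ p : List ℕ, p.length = 3 → p.getD 0 0 < p.getD 2 0 → AvoidsPattern Y p := by
      rintro p hp h02 ⟨s, hs, hl, hiff⟩
      rw [hp] at hl
      obtain ⟨f, hf⟩ := List.sublist_iff_exists_orderEmbedding_getElem?_eq.1 hs
      have h01 : f 0 < f 1 := f.lt_iff_lt.2 (by omega)
      have h12 : f 1 < f 2 := f.lt_iff_lt.2 (by omega)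
      have hf2 := hf 2
      have hlen : f 2 < Y.length := by
        by_contra hge
        rw [List.getElem?_eq_none (l := Y) (by omega), List.getElem?_eq_none_iff] at hf2
        omega
      have h1 := h (f 0) (f 2) (by omega) hlen
      have h2 := (hiff 0 2 (by omega) (by omega)).2 h02
      rw [List.getD_eq_getElem?_getD, List.getD_eq_getElem?_getD, ← hf, ← hf] at h1
      rw [List.getD_eq_getElem?_getD, List.getD_eq_getElem?_getD] at h2
      omega
    exact ⟨key _ rfl (by simp), key _ rfl (by simp), key _ rfl (by simp)⟩

theorem SwapLayered.gapDecreasing {S Y : List ℕ} (h : SwapLayered S Y)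
    (hS : S.Pairwise (· > ·)) : GapDecreasing Y := by
  induction h with
  | nil => exact gapDecreasing_of_length_le (by simp)
  | @keep S Y s hL ih =>
    rw [List.pairwise_cons] at hS
    exact gapDecreasing_cons.2
      ⟨fun z hz => hS.1 z (hL.perm.mem_iff.2 (List.mem_of_mem_drop hz)), ih hS.2⟩
  | @swap S Y s a hL ih =>
    simp only [List.pairwise_cons] at hS
    refine gapDecreasing_cons.2 ⟨fun z hz => hS.2.1 z (hL.perm.mem_iff.2 (by simpa using hz)),
      gapDecreasing_cons.2 ⟨fun z hz => ?_, ih hS.2.2⟩⟩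
    exact hS.1 z (List.mem_cons_of_mem _ (hL.perm.mem_iff.2 (List.mem_of_mem_drop hz)))

theorem GapDecreasing.swapLayered {S Y : List ℕ} (h : GapDecreasing Y)
    (hS : S.Pairwise (· > ·)) (hp : S.Perm Y) : SwapLayered S Y := by
  match Y with
  | [] =>
    rw [hp.eq_nil]
    exact .nil
  | [y] =>
    rw [List.perm_singleton.1 hp]
    exact .keep y .nil
  | y :: z :: Y =>
    match S with
    | [] => simp at hp
    | s :: S =>
    rw [gapDecreasing_cons] at h
    by_cases hys : y = s
    · subst hys
      exact .keep y (h.2.swapLayered (List.pairwise_cons.1 hS).2 hp.cons_inv)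
    have hyS : y ∈ S := by
      have := hp.mem_iff.2 (List.mem_cons_self)
      simpa [hys] using this
    have hsy : y < s := (List.pairwise_cons.1 hS).1 y hyS
    have hsz : s = z := by
      have := hp.mem_iff.1 (List.mem_cons_self)
      simp only [List.mem_cons] at this
      rcases this with h' | h' | h'
      · omega
      · exact h'
      · have := h.1 s (by simpa using h')
        omega
    subst hsz
    have hp' : S.Perm (y :: Y) := (hp.trans (List.Perm.swap s y Y)).cons_inv
    match S with
    | [] => simp at hyS
    | t :: S =>
    have hty : t = y := by
      by_contra hty
      have h1 : t < y := h.1 t (by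
        have := hp'.mem_iff.1 (List.mem_cons_self)
        simpa [hty] using this)
      have h2 : y ∈ S := by simpa [Ne.symm hty] using hyS
      have := (List.pairwise_cons.1 (List.pairwise_cons.1 hS).2).1 y h2
      omega
    subst hty
    exact .swap s t ((gapDecreasing_cons.1 h.2).2.swapLayered
      (List.pairwise_cons.1 (List.pairwise_cons.1 hS).2).2 hp'.cons_inv)
  termination_by Y.length

/-- The order-theoretic form of the sortability criterion, for the stack contents `R` after
reading the first half and the second half `y :: Y`. -/
theorem sortable_cases_iff_gapDecreasing {m y : ℕ} {R Y : List ℕ}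
    (hR : (m :: R).Pairwise (· > ·)) (hp : (m :: R).Perm (y :: Y)) :
    (SwapLayered (m :: R) (y :: Y) ∨ ∃ A c B, m :: R = A ++ c :: B ∧
        ((∃ Y', y :: Y = c :: Y' ∧ SwapLayered (A ++ B) Y') ∨
          ∃ a S Y', y :: Y = a :: c :: Y' ∧ A ++ B = a :: S ∧ SwapLayered S Y')) ↔
      (y < m ∧ GapDecreasing Y) ∨ (y = m ∧ GapDecreasing (Y.drop 1)) := by
  have hym : y ≤ m := by
    have := hp.mem_iff.2 (List.mem_cons_self)
    rcases List.mem_cons.1 this with h | h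
    · exact h.le
    · exact ((List.pairwise_cons.1 hR).1 y h).le
  have htail : GapDecreasing Y → GapDecreasing (Y.drop 1) := by
    cases Y with
    | nil => exact id
    | cons z Y => exact fun h => (gapDecreasing_cons.1 h).2
  have hof : GapDecreasing Y →
      (y < m ∧ GapDecreasing Y) ∨ (y = m ∧ GapDecreasing (Y.drop 1)) := fun h =>
    (lt_or_eq_of_le hym).imp (fun h' => ⟨h', h⟩) fun h' => ⟨h', htail h⟩
  have hsub : ∀ A c B, m :: R = A ++ c :: B → (A ++ B).Pairwise (· > ·) := by
    intro A c B h
    rw [h] at hR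
    exact hR.sublist ((List.sublist_cons_self c B).append_left A)
  constructor
  · rintro (h | ⟨A, c, B, hX, h⟩)
    · exact hof (gapDecreasing_cons.1 (h.gapDecreasing hR)).2
    rcases h with ⟨Y', hY, h⟩ | ⟨a, S, Y', hY, hS, h⟩
    · obtain ⟨rfl, rfl⟩ := List.cons.inj hY
      exact hof (h.gapDecreasing (hsub _ _ _ hX))
    · obtain ⟨rfl, rfl⟩ := List.cons.inj hY
      have hAB := hsub _ _ _ hX
      rw [hS] at hAB
      have hg := h.gapDecreasing (List.pairwise_cons.1 hAB).2
      rcases lt_or_eq_of_le hym with hlt | heq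
      · refine .inl ⟨hlt, gapDecreasing_cons.2 ⟨fun z hz => ?_, hg⟩⟩
        have hzS : z ∈ S := h.perm.mem_iff.2 (List.mem_of_mem_drop hz)
        cases A with
        | nil =>
          obtain ⟨rfl, rfl⟩ := List.cons.inj hX
          simp only [List.nil_append] at hS
          exact (List.pairwise_cons.1 hR).1 z (by simp [hS, hzS])
        | cons x A =>
          have h1 := (List.cons.inj hX).1
          have h2 := (List.cons.inj hS).1
          omega
      · exact .inr ⟨heq, hg⟩
  · rintro (⟨hlt, hg⟩ | ⟨rfl, hg⟩)
    · obtain ⟨A, B, hX⟩ := List.append_of_mem (hp.mem_iff.2 (List.mem_cons_self))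
      refine .inr ⟨A, y, B, hX, .inl ⟨Y, rfl, hg.swapLayered (hsub _ _ _ hX) ?_⟩⟩
      rw [hX] at hp
      exact (List.perm_middle.symm.trans hp).cons_inv
    · cases Y with
      | nil =>
        have := hp.cons_inv.eq_nil
        subst this
        exact .inl (.keep y .nil)
      | cons z Y =>
        have hp' := hp.cons_inv
        obtain ⟨A, B, rfl⟩ := List.append_of_mem (hp'.mem_iff.2 (List.mem_cons_self))
        have hAB := List.pairwise_cons.1 (hsub (y :: A) z B rfl)
        exact .inr ⟨y :: A, z, B, rfl, .inr ⟨y, A ++ B, Y, rfl, rfl,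
          GapDecreasing.swapLayered hg hAB.2 (List.perm_middle.symm.trans hp').cons_inv⟩⟩

theorem footSortable_append_iff {X Y : List ℕ} (hX : X.Nodup) (hY : Y.Perm X) :
    FootSortable 1 (⟦X ++ Y⟧ : SockOrdering) ↔
      ∃ o, StackRun (X ++ Y) [] o ∧ PairedWord o := by
  rw [footSortable_one_iff]
  refine exists_congr fun o => and_congr_right fun hr => ?_
  have hcount : ∀ a, o.count a = X.count a + X.count a := fun a => by
    rw [hr.perm.count_eq, List.append_nil, List.count_append, hY.count_eq]
  refine ⟨fun h => h.pairedWord fun a ha => ?_, fun h => h.sortedWordSock fun a => ?_⟩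
  · have h1 : X.count a ≤ 1 := List.nodup_iff_count_le_one.1 hX a
    have h2 := List.count_pos_iff.2 ha
    have := hcount a
    omega
  · have h1 : X.count a ≤ 1 := List.nodup_iff_count_le_one.1 hX a
    have := hcount a
    omega

theorem permWord_nodup (n : ℕ) (σ : Equiv.Perm (Fin n)) : (permWord n σ).Nodup :=
  (List.nodup_finRange n).map fun i j h => σ.injective (Fin.ext (by simpa using h))

theorem permWord_perm (n : ℕ) (σ τ : Equiv.Perm (Fin n)) :
    (permWord n σ).Perm (permWord n τ) := by
  have key : ∀ ρ : Equiv.Perm (Fin n), ∀ a, a ∈ permWord n ρ ↔ ∃ i : Fin n, (i : ℕ) + 1 = a := by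
    intro ρ a
    simp only [permWord, List.mem_map, List.mem_finRange, true_and]
    exact ρ.exists_congr_left.trans (by simp)
  exact (List.perm_ext_iff_of_nodup (permWord_nodup n σ) (permWord_nodup n τ)).2 fun a =>
    (key σ a).trans (key τ a).symm

theorem afWord_eq (n : ℕ) (σ : Equiv.Perm (Fin n)) : afWord n σ = permWord n 1 ++ permWord n σ := by
  simp [afWord, permWord, ← List.map_eq_flatMap, -List.map_coe_finRange_eq_range]

theorem permWord_one_pairwise (n : ℕ) : (permWord n 1).reverse.Pairwise (· > ·) := by
  rw [List.pairwise_reverse, permWord, List.pairwise_map]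
  exact (List.pairwise_lt_finRange n).imp fun h => by simpa using h

theorem permWord_one_reverse_succ (n : ℕ) :
    ∃ R, (permWord (n + 1) 1).reverse = (n + 1) :: R := by
  rw [permWord, List.finRange_succ_last]
  simp

theorem permWord_succ (n : ℕ) (σ : Equiv.Perm (Fin (n + 1))) :
    ∃ Y, permWord (n + 1) σ = ((σ 0 : ℕ) + 1) :: Y := by
  rw [permWord, List.finRange_succ]
  simp

/-- characterization of foot-sortable alignment-free 2-uniform sock orderings. -/
theorem alignmentFree_footSortable_iff (n : ℕ) (hn : 1 ≤ n) (σ : Equiv.Perm (Fin n)) :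
    FootSortable 1 (⟦afWord n σ⟧ : SockOrdering) ↔
      ((((σ ⟨0, hn⟩ : Fin n) : ℕ) + 1 < n ∧ Avoids123_132_213 ((permWord n σ).drop 1)) ∨
       (((σ ⟨0, hn⟩ : Fin n) : ℕ) + 1 = n ∧ Avoids123_132_213 ((permWord n σ).drop 2))) := by
  obtain ⟨n, rfl⟩ : ∃ k, n = k + 1 := ⟨n - 1, by omega⟩
  have hperm := permWord_perm (n + 1) σ 1
  have hnd := permWord_nodup (n + 1) σ
  rw [afWord_eq, footSortable_append_iff (permWord_nodup _ 1) hperm,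
    exists_stackRun_append_iff (permWord_nodup _ 1) hperm,
    avoids_iff_gapDecreasing (hnd.sublist (List.drop_sublist 1 _)),
    avoids_iff_gapDecreasing (hnd.sublist (List.drop_sublist 2 _))]
  have hpw := permWord_one_pairwise (n + 1)
  have hpr := (List.reverse_perm _).trans hperm.symm
  obtain ⟨R, hR⟩ := permWord_one_reverse_succ n
  obtain ⟨Y, hY⟩ := permWord_succ n σ
  rw [hR] at hpw hpr ⊢
  rw [hY] at hpr ⊢
  exact sortable_cases_iff_gapDecreasing hpw hpr
end

section
/- Let n ≥ 2 and r ≥ 1 be integers, and set r' = r²·binom(n, ⌈n/2⌉). If ρ is an r'-uniform stratified sock ordering with n colors, then every sock ordering in foot(ρ) contains an r-uniform stratified sock ordering with ⌈n/2⌉ colors as a pattern. -/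
/-- The word `l` has a subsequence made of `k` consecutive arrangements of the letters of `A`. -/
def HasStrata (A : Finset ℕ) (k : ℕ) (l : List ℕ) : Prop :=
  ∃ blocks : List (List ℕ), blocks.length = k ∧ blocks.flatten.Sublist l ∧
    ∀ b ∈ blocks, b.Nodup ∧ b.toFinset = A

theorem hasStrata_zero (A : Finset ℕ) (l : List ℕ) : HasStrata A 0 l :=
  ⟨[], rfl, by simp, by simp⟩

theorem HasStrata.append_left {A : Finset ℕ} {k : ℕ} {l₁ l₂ : List ℕ} (h₁ : A ⊆ l₁.toFinset)
    (h₂ : HasStrata A k l₂) : HasStrata A (k + 1) (l₁ ++ l₂) := by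
  obtain ⟨blocks, hk, hsub, hb⟩ := h₂
  refine ⟨(l₁.filter (· ∈ A)).dedup :: blocks, by simp [hk], ?_, ?_⟩
  · rw [List.flatten_cons]
    exact ((List.dedup_sublist _).trans List.filter_sublist).append hsub
  · intro b hbm
    rcases List.mem_cons.1 hbm with rfl | hbm
    · refine ⟨List.nodup_dedup _, ?_⟩
      ext a
      simp only [List.mem_toFinset, List.mem_dedup, List.mem_filter, decide_eq_true_eq,
        and_iff_right_iff_imp]
      exact fun ha => List.mem_toFinset.1 (h₁ ha)
    · exact hb b hbm

theorem HasStrata.drop_of_drop {A : Finset ℕ} {k s t : ℕ} {out : List ℕ} (hst : s ≤ t)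
    (hA : ∀ a ∈ A, ∃ p, s ≤ p ∧ p < t ∧ out[p]? = some a)
    (h : HasStrata A k (out.drop t)) : HasStrata A (k + 1) (out.drop s) := by
  have hdrop : out.drop t = (out.drop s).drop (t - s) := by
    rw [List.drop_drop]; congr 1; omega
  rw [← List.take_append_drop (t - s) (out.drop s)]
  rw [hdrop] at h
  refine h.append_left fun a ha => ?_
  obtain ⟨p, hsp, hpt, hp⟩ := hA a ha
  rw [List.mem_toFinset]
  refine List.mem_of_getElem? (i := p - s) ?_
  rw [List.getElem?_take_of_lt (by omega), List.getElem?_drop, ← hp]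
  congr 1; omega

/-- Pairwise separated occurrences of the letters of `A` give strata. -/
theorem hasStrata_of_separated {A : Finset ℕ} (hA : A.Nonempty) {out : List ℕ}
    (v : ℕ → ℕ → ℕ) (K : Finset ℕ) (s : ℕ)
    (hsep : ∀ i ∈ K, ∀ j ∈ K, i < j →
      (∀ a ∈ A, ∀ b ∈ A, v i a < v j b) ∨ (∀ a ∈ A, ∀ b ∈ A, v j b < v i a))
    (hs : ∀ i ∈ K, ∀ a ∈ A, s ≤ v i a)
    (hout : ∀ i ∈ K, ∀ a ∈ A, out[v i a]? = some a) :
    HasStrata A K.card (out.drop s) := by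
  induction hc : K.card generalizing K s with
  | zero => exact hasStrata_zero _ _
  | succ k ih =>
    obtain ⟨a₀, ha₀⟩ := hA
    have hK : K.Nonempty := Finset.card_pos.1 (by omega)
    obtain ⟨i, hi, hmin⟩ := K.exists_min_image (fun i => v i a₀) hK
    have hfirst : ∀ j ∈ K, j ≠ i → ∀ a ∈ A, ∀ b ∈ A, v i a < v j b := by
      intro j hj hji a ha b hb
      have := hmin j hj
      rcases lt_or_gt_of_ne hji with h | h
      · rcases hsep j hj i hi h with h' | h'
        · have := h' a₀ ha₀ a₀ ha₀; omega
        · exact h' b hb a ha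
      · rcases hsep i hi j hj h with h' | h'
        · exact h' a ha b hb
        · have := h' a₀ ha₀ a₀ ha₀; omega
    have hle : ∀ a ∈ A, v i a < A.sup (v i) + 1 := fun a ha =>
      Nat.lt_succ_of_le (Finset.le_sup (f := v i) ha)
    obtain ⟨a₁, ha₁, hsup⟩ := A.exists_mem_eq_sup ⟨a₀, ha₀⟩ (v i)
    refine HasStrata.drop_of_drop (t := A.sup (v i) + 1) ?_ ?_ (ih (K.erase i) _ ?_ ?_ ?_ ?_)
    · have := hs i hi a₀ ha₀
      have := hle a₀ ha₀
      omega
    · exact fun a ha => ⟨v i a, hs i hi a ha, hle a ha, hout i hi a ha⟩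
    · exact fun x hx y hy => hsep x (Finset.mem_of_mem_erase hx) y (Finset.mem_of_mem_erase hy)
    · intro j hj b hb
      rw [hsup]
      exact hfirst j (Finset.mem_of_mem_erase hj) (Finset.ne_of_mem_erase hj) a₁ ha₁ b hb
    · exact fun j hj => hout j (Finset.mem_of_mem_erase hj)
    · rw [Finset.card_erase_of_mem hi]; omega

/-- A set of at least `2 * q + 1` numbers has a subset of size `q + 1` no two elements of which
are consecutive in it. -/
theorem exists_subset_separated {K : Finset ℕ} {q : ℕ} (h : 2 * q < K.card) :
    ∃ K' ⊆ K, K'.card = q + 1 ∧ ∀ i ∈ K', ∀ j ∈ K', i < j → ∃ x ∈ K, i < x ∧ x < j := by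
  let e := K.orderEmbOfFin rfl
  let f : Fin (q + 1) → ℕ := fun x => e ⟨2 * x, by omega⟩
  have hf : StrictMono f := fun x y hxy =>
    e.strictMono (Fin.mk_lt_mk.2 (by have := Fin.lt_def.1 hxy; omega))
  refine ⟨Finset.univ.image f, ?_, ?_, ?_⟩
  · intro x hx
    obtain ⟨y, -, rfl⟩ := Finset.mem_image.1 hx
    exact K.orderEmbOfFin_mem rfl _
  · rw [Finset.card_image_of_injective _ hf.injective, Finset.card_univ, Fintype.card_fin]
  · intro i hi j hj hij
    obtain ⟨x, -, rfl⟩ := Finset.mem_image.1 hi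
    obtain ⟨y, -, rfl⟩ := Finset.mem_image.1 hj
    have hxy := Fin.lt_def.1 (hf.lt_iff_lt.1 hij)
    have hy := y.2
    refine ⟨e ⟨2 * x + 1, by omega⟩, K.orderEmbOfFin_mem rfl _, ?_, ?_⟩
    · exact e.strictMono (Fin.mk_lt_mk.2 (by omega))
    · exact e.strictMono (Fin.mk_lt_mk.2 (by omega))

/-- Here `v j a` is the position in the output of the letter `a` of block `j`, and `T j` is the
length of the output when block `j` has just been pushed. -/
theorem exists_hasStrata_of_popTimes {m N : ℕ} (cols : Finset ℕ) (hm : 0 < m)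
    (hmn : 2 * m ≤ cols.card + 1) (T : ℕ → ℕ) (v : ℕ → ℕ → ℕ) (out : List ℕ)
    (hT : ∀ i j, i ≤ j → j < N → T i ≤ T j)
    (hafter : ∀ i j a, i < j → j < N → a ∈ cols → T i ≤ v j a)
    (hnest : ∀ i j a b, i < j → j < N → a ∈ cols → b ∈ cols → T j ≤ v i a → v j b < v i a)
    (hout : ∀ j a, j < N → a ∈ cols → out[v j a]? = some a) (q s t : ℕ)
    (hN : s + cols.card.choose m * q * q + q ≤ N + cols.card.choose m * q)
    (ht : ∀ j a, s ≤ j → j < N → a ∈ cols → t ≤ v j a) :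
    ∃ A ∈ cols.powersetCard m, HasStrata A q (out.drop t) := by
  induction q generalizing s t with
  | zero =>
    obtain ⟨A, hA⟩ := Finset.powersetCard_nonempty.2 (show m ≤ cols.card by omega)
    exact ⟨A, hA, hasStrata_zero _ _⟩
  | succ q ih =>
    set C := cols.card.choose m with hC
    have hN' : s + C * q * q + C * q + q + 1 ≤ N := by nlinarith
    have hqq : C * q ≤ C * q * q := by
      rcases Nat.eq_zero_or_pos q with rfl | hq
      · simp
      · exact Nat.le_mul_of_pos_right _ hq
    obtain ⟨k, hk⟩ : ∃ k, k = s + 2 * (C * q) := ⟨_, rfl⟩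
    have hkN : k < N := by omega
    by_cases hfull : ∃ i, s ≤ i ∧ i ≤ k ∧ ∀ a ∈ cols, v i a < T k
    · obtain ⟨i, hsi, hik, hi⟩ := hfull
      obtain ⟨A, hA, hstr⟩ := ih (k + 1) (T k) (by omega)
        fun j a hj hjN ha => hafter k j a hj hjN ha
      have hAc := (Finset.mem_powersetCard.1 hA).1
      obtain ⟨a₀, ha₀⟩ := Finset.card_pos.1 (show 0 < cols.card by omega)
      refine ⟨A, hA, hstr.drop_of_drop ?_ ?_⟩
      · exact (ht i a₀ hsi (by omega) ha₀).trans (hi a₀ ha₀).le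
      · exact fun a ha => ⟨v i a, ht i a hsi (by omega) (hAc ha), hi a (hAc ha),
          hout i a (by omega) (hAc ha)⟩
    · push Not at hfull
      have hcolor : ∀ i, ∃ A ∈ cols.powersetCard m,
          (∀ a ∈ A, v i a < T k) ∨ (∀ a ∈ A, T k ≤ v i a) := by
        intro i
        have hsum := Finset.card_filter_add_card_filter_not (s := cols) (fun a => v i a < T k)
        rcases le_or_gt m (cols.filter fun a => v i a < T k).card with h | h
        · obtain ⟨A, hA, hAm⟩ := Finset.exists_subset_card_eq h
          exact ⟨A, Finset.mem_powersetCard.2 ⟨hA.trans (Finset.filter_subset _ _), hAm⟩,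
            Or.inl fun a ha => (Finset.mem_filter.1 (hA ha)).2⟩
        · obtain ⟨A, hA, hAm⟩ := Finset.exists_subset_card_eq
            (show m ≤ (cols.filter fun a => ¬ v i a < T k).card by omega)
          exact ⟨A, Finset.mem_powersetCard.2 ⟨hA.trans (Finset.filter_subset _ _), hAm⟩,
            Or.inr fun a ha => not_lt.1 (Finset.mem_filter.1 (hA ha)).2⟩
      choose A hA hAT using hcolor
      obtain ⟨D, hD, hDcard⟩ := Finset.exists_lt_card_fiber_of_mul_lt_card_of_maps_to
        (s := Finset.Icc s k) (t := cols.powersetCard m) (f := A) (n := 2 * q)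
        (fun i _ => hA i) (by
          rw [Finset.card_powersetCard, Nat.card_Icc, ← hC, Nat.mul_left_comm]; omega)
      obtain ⟨hDc, hDm⟩ := Finset.mem_powersetCard.1 hD
      obtain ⟨K, hKsub, hKcard, hK⟩ := exists_subset_separated hDcard
      have hmem : ∀ i ∈ K, s ≤ i ∧ i ≤ k ∧ A i = D := fun i hi => by
        have := hKsub hi
        rw [Finset.mem_filter, Finset.mem_Icc] at this
        exact ⟨this.1.1, this.1.2, this.2⟩
      refine ⟨D, hD, hKcard ▸ hasStrata_of_separated (Finset.card_pos.1 (by omega)) v K t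
        ?_ ?_ ?_⟩
      · intro i hi j hj hij
        obtain ⟨hsi, hik, hiD⟩ := hmem i hi
        obtain ⟨hsj, hjk, hjD⟩ := hmem j hj
        have hiT := hiD ▸ hAT i
        have hjT := hjD ▸ hAT j
        rcases hiT with hiT | hiT <;> rcases hjT with hjT | hjT
        · left
          intro a ha b hb
          obtain ⟨x, hx, hix, hxj⟩ := hK i hi j hj hij
          have hxk : s ≤ x ∧ x ≤ k := Finset.mem_Icc.1 (Finset.mem_filter.1 hx).1
          obtain ⟨y, hy, hyT⟩ := hfull x hxk.1 hxk.2
          have h₁ : v i a < T x := by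
            by_contra! h
            have := hnest i x a y hix (by omega) (hDc ha) hy h
            have := hiT a ha
            omega
          exact h₁.trans_le (hafter x j b hxj (by omega) (hDc hb))
        · exact Or.inl fun a ha b hb => (hiT a ha).trans_le (hjT b hb)
        · exact Or.inr fun a ha b hb => (hjT b hb).trans_le (hiT a ha)
        · exact Or.inr fun a ha b hb => hnest i j a b hij (by omega) (hDc ha) (hDc hb)
            ((hT j k hjk hkN).trans (hiT a ha))
      · exact fun i hi a ha => ht i a (hmem i hi).1
          ((hmem i hi).2.1.trans_lt hkN) (hDc ha)
      · exact fun i hi a ha => hout i a ((hmem i hi).2.1.trans_lt hkN) (hDc ha)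

/-- For a letter at position `x` of the input, `v x` is its position in the output and `u x` is
the length of the output at the time it is pushed; the letters in the stack count as pushed at
the start. -/
theorem exists_times_of_reachable {σ : List ℕ × List ℕ × List ℕ} {out : List ℕ}
    (h : Relation.ReflTransGen StackStep σ ([], [], out)) :
    σ.2.2 <+: out ∧ ∃ u v : ℕ → ℕ,
      (∀ x < σ.2.1.length, u x = σ.2.2.length) ∧
      (∀ x < σ.2.1.length + σ.1.length,
        out[v x]? = (σ.2.1.reverse ++ σ.1)[x]? ∧ σ.2.2.length ≤ u x ∧ u x ≤ v x) ∧
      (∀ x y, x ≤ y → y < σ.2.1.length + σ.1.length → u x ≤ u y) ∧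
      (∀ x y, x < y → y < σ.2.1.length + σ.1.length → u y ≤ v x → v y < v x) := by
  induction h using Relation.ReflTransGen.head_induction_on with
  | refl => exact ⟨List.prefix_rfl, id, id, by simp, by simp, by simp, by simp⟩
  | head hstep _ ih =>
    cases hstep with
    | push a inp st o =>
      obtain ⟨hpre, u, v, h₁, h₂, h₃, h₄⟩ := ih
      simp only [List.length_cons, List.reverse_cons, List.append_assoc,
        List.singleton_append] at *
      refine ⟨hpre, u, v, fun x hx => h₁ x (by omega), fun x hx => h₂ x (by omega),
        fun x y hxy hy => h₃ x y hxy (by omega), fun x y hxy hy => h₄ x y hxy (by omega)⟩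
    | pop a inp st o =>
      obtain ⟨hpre, u, v, h₁, h₂, h₃, h₄⟩ := ih
      simp only [List.length_cons, List.reverse_cons, List.append_assoc,
        List.singleton_append, List.length_append, List.length_nil] at *
      refine ⟨(List.prefix_append o [a]).trans hpre,
        fun x => if x ≤ st.length then o.length else u (x - 1),
        fun x => if x < st.length then v x else if x = st.length then o.length else v (x - 1),
        ?_, ?_, ?_, ?_⟩
      · intro x hx
        simp only [ite_eq_left_iff]
        omega
      · intro x hx
        rcases lt_trichotomy x st.length with hlt | rfl | hgt
        · obtain ⟨e, f, g⟩ := h₂ x (by omega)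
          have := h₁ x hlt
          simp only [hlt, hlt.le, if_true]
          refine ⟨?_, le_rfl, by omega⟩
          rw [e, List.getElem?_append_left (by simpa), List.getElem?_append_left (by simpa)]
        · simp only [le_refl, lt_irrefl, if_true, if_false, and_self, and_true]
          obtain ⟨l, rfl⟩ := hpre
          simp [List.append_assoc]
        · obtain ⟨e, f, g⟩ := h₂ (x - 1) (by omega)
          simp only [not_lt.2 hgt.le, not_le.2 hgt, hgt.ne', if_false]
          refine ⟨?_, by omega, g⟩
          rw [e, List.getElem?_append_right (by simp; omega),
            List.getElem?_append_right (by simp; omega), List.length_reverse,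
            show x - st.length = (x - 1 - st.length) + 1 by omega, List.getElem?_cons_succ]
      · intro x y hxy hy
        have := h₂ (y - 1)
        have := h₃ (x - 1) (y - 1)
        dsimp only
        split_ifs <;> omega
      · intro x y hxy hy
        have := h₁ y
        have := h₂ x
        have := h₂ (y - 1)
        have := h₄ x y hxy
        have := h₄ x (y - 1)
        have := h₄ (x - 1) (y - 1)
        dsimp only
        split_ifs <;> omega

theorem getElem?_flatten_of_length_eq {n : ℕ} {blocks : List (List ℕ)}
    (hlen : ∀ b ∈ blocks, b.length = n) {j k : ℕ} (hj : j < blocks.length) (hk : k < n) :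
    blocks.flatten[j * n + k]? = blocks[j][k]? := by
  induction blocks generalizing j with
  | nil => simp at hj
  | cons b bs ih =>
    have hb : b.length = n := hlen b (by simp)
    rw [List.flatten_cons]
    cases j with
    | zero => rw [List.getElem?_append_left (by omega)]; simp
    | succ j =>
      have hj' : j < bs.length := by simpa using hj
      rw [List.getElem?_append_right (by rw [hb, Nat.succ_mul]; omega), hb,
        show (j + 1) * n + k - n = j * n + k by rw [Nat.succ_mul]; omega,
        ih (fun c hc => hlen c (by simp [hc])) hj']
      simp

theorem exists_hasStrata_of_isStackOutput {m n N q : ℕ} {cols : Finset ℕ}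
    {blocks : List (List ℕ)} {out : List ℕ} (hm : 0 < m) (hmn : 2 * m ≤ n + 1)
    (hcard : cols.card = n) (hlen : blocks.length = N)
    (hblocks : ∀ b ∈ blocks, b.length = n ∧ b.toFinset = cols)
    (hq : n.choose m * q * q + q ≤ N + n.choose m * q)
    (h : IsStackOutput blocks.flatten out) :
    ∃ A ∈ cols.powersetCard m, HasStrata A q out := by
  obtain ⟨-, u, v, -, h₂, h₃, h₄⟩ := exists_times_of_reachable h
  have hflat : blocks.flatten.length = N * n := by
    rw [List.length_flatten, List.eq_replicate_of_mem (l := blocks.map List.length) (a := n)]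
    · simp [hlen]
    · intro x hx
      obtain ⟨b, hb, rfl⟩ := List.mem_map.1 hx
      exact (hblocks b hb).1
  simp only [List.length_nil, zero_add, List.reverse_nil, List.nil_append, hflat] at *
  let p : ℕ → ℕ → ℕ := fun j a => j * n + (blocks.getD j []).idxOf a
  have hp : ∀ j a, j < N → a ∈ cols →
      j * n ≤ p j a ∧ p j a < (j + 1) * n ∧ blocks.flatten[p j a]? = some a := by
    intro j a hj ha
    have hj' : j < blocks.length := by omega
    obtain ⟨hl, hc⟩ := hblocks blocks[j] (List.getElem_mem hj')
    have hmem : a ∈ blocks[j] := by rw [← List.mem_toFinset, hc]; exact ha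
    have hidx := List.idxOf_lt_length_of_mem hmem
    have hget : blocks.getD j [] = blocks[j] := List.getD_eq_getElem _ _ hj'
    refine ⟨by simp [p], by simp only [p, hget, Nat.succ_mul]; omega, ?_⟩
    simp only [p, hget]
    rw [getElem?_flatten_of_length_eq (fun b hb => (hblocks b hb).1) hj' (by omega)]
    simp [hidx]
  have hmul : ∀ {i j : ℕ}, i < j → (i + 1) * n ≤ j * n := fun hij => Nat.mul_le_mul_right n hij
  have hpN : ∀ j a, j < N → a ∈ cols → p j a < N * n := fun j a hj ha =>
    (hp j a hj ha).2.1.trans_le (hmul hj)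
  have hpos : ∀ j, 0 < (j + 1) * n := fun j => Nat.mul_pos j.succ_pos (by omega)
  subst hcard
  refine exists_hasStrata_of_popTimes cols hm hmn (fun j => u ((j + 1) * cols.card - 1))
    (fun j a => v (p j a)) out ?_ ?_ ?_ ?_ q 0 0
    (by rw [Nat.zero_add]; exact hq) (by simp)
  · intro i j hij hj
    have := hmul hj
    have : (i + 1) * cols.card ≤ (j + 1) * cols.card := hmul (Nat.lt_succ_of_le hij)
    have := hpos j
    exact h₃ _ _ (by omega) (by omega)
  · intro i j a hij hj ha
    have := hmul hij
    have := (hp j a hj ha).1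
    exact (h₃ _ _ (by omega) (hpN j a hj ha)).trans (h₂ _ (hpN j a hj ha)).2.2
  · intro i j a b hij hj ha hb hTv
    have := hmul hij
    have := (hp i a (by omega) ha).2.1
    have := (hp j b hj hb)
    have := hmul hj
    exact h₄ _ _ (by omega) (hpN j b hj hb)
      ((h₃ _ ((j + 1) * cols.card - 1) (by omega) (by have := hpos j; omega)).trans hTv)
  · intro j a hj ha
    rw [(h₂ _ (hpN j a hj ha)).1, (hp j a hj ha).2.2]

theorem SockEquiv.exists_map_eq {w v : List ℕ} (h : SockEquiv w v) :
    ∃ f : ℕ → ℕ, Set.InjOn f {a | a ∈ w} ∧ v = w.map f := by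
  obtain ⟨hl, he⟩ := h
  have hidx : ∀ a ∈ w, w.idxOf a < w.length ∧ w.getD (w.idxOf a) 0 = a := fun a ha => by
    have h := List.idxOf_lt_length_of_mem ha
    exact ⟨h, by rw [List.getD_eq_getElem _ _ h]; simp⟩
  refine ⟨fun a => v.getD (w.idxOf a) 0, ?_, ?_⟩
  · intro a ha b hb hab
    obtain ⟨ha₁, ha₂⟩ := hidx a ha
    obtain ⟨hb₁, hb₂⟩ := hidx b hb
    rw [← ha₂, ← hb₂]
    exact (he _ _ ha₁ hb₁).2 hab
  · refine List.ext_getElem (by simp [hl]) fun i hi _ => ?_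
    have hiw : i < w.length := by omega
    obtain ⟨h₁, h₂⟩ := hidx w[i] (List.getElem_mem hiw)
    rw [List.getElem_map, ← List.getD_eq_getElem v 0 hi]
    refine (he _ _ hiw h₁).1 ?_
    rw [h₂, List.getD_eq_getElem _ _ hiw]

theorem StratifiedWord.congr {n r : ℕ} {w v : List ℕ} (hw : StratifiedWord n r w)
    (h : SockEquiv w v) : StratifiedWord n r v := by
  obtain ⟨f, hf, rfl⟩ := h.exists_map_eq
  obtain ⟨blocks, hlen, rfl, hb⟩ := hw
  refine ⟨blocks.map (List.map f), by simp [hlen], by rw [List.map_flatten], ?_⟩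
  intro c hc
  obtain ⟨b, hbm, rfl⟩ := List.mem_map.1 hc
  obtain ⟨h₁, h₂, h₃⟩ := hb b hbm
  have hsub : ∀ a ∈ b, a ∈ blocks.flatten := fun a ha => List.mem_flatten.2 ⟨b, hbm, ha⟩
  refine ⟨by simp [h₁], h₂.map_on fun a ha a' ha' haa => hf (hsub a ha) (hsub a' ha') haa, ?_⟩
  have hmem : ∀ a, a ∈ b ↔ a ∈ blocks.flatten := fun a => by
    rw [← List.mem_toFinset, h₃, List.mem_toFinset]
  ext c
  simp only [List.mem_toFinset, List.mem_map, hmem]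

theorem HasStrata.exists_stratifiedWord {A : Finset ℕ} {r : ℕ} {l : List ℕ} (hr : 0 < r)
    (h : HasStrata A r l) : ∃ u, u.Sublist l ∧ StratifiedWord A.card r u := by
  obtain ⟨blocks, hlen, hsub, hb⟩ := h
  have hflat : blocks.flatten.toFinset = A := by
    ext a
    rw [List.mem_toFinset, List.mem_flatten]
    constructor
    · rintro ⟨b, hbm, ha⟩
      rw [← (hb b hbm).2]
      exact List.mem_toFinset.2 ha
    · intro ha
      obtain ⟨b, hbm⟩ := List.exists_mem_of_length_pos (hlen.symm ▸ hr)
      exact ⟨b, hbm, List.mem_toFinset.1 ((hb b hbm).2 ▸ ha)⟩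
  refine ⟨_, hsub, blocks, hlen, rfl, fun b hbm => ?_⟩
  obtain ⟨h₁, h₂⟩ := hb b hbm
  exact ⟨by rw [← List.toFinset_card_of_nodup h₁, h₂], h₁, h₂.trans hflat.symm⟩

/-- every sock ordering in `foot ρ`, for `ρ` an `r²·C(n,⌈n/2⌉)`-uniform stratified
sock ordering with `n` colors, contains an `r`-uniform stratified sock ordering with `⌈n/2⌉`
colors as a pattern. -/
theorem foot_of_stratified_contains_stratified (n r : ℕ) (hn : 2 ≤ n) (hr : 1 ≤ r)
    (ρ : SockOrdering) (hρ : IsStratified n (r ^ 2 * n.choose ((n + 1) / 2)) ρ) :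
    ∀ κ ∈ foot ρ, ∃ η : SockOrdering,
      IsStratified ((n + 1) / 2) r η ∧ Contains κ η := by
  rintro κ ⟨w, out, hw, hout, rfl⟩
  obtain ⟨w₀, hw₀, hstrat⟩ := hρ
  obtain ⟨blocks, hlen, rfl, hb⟩ := hstrat.congr (Quotient.exact (hw₀.trans hw.symm))
  have hC : 0 < n.choose ((n + 1) / 2) := Nat.choose_pos (by omega)
  obtain ⟨b, hbm⟩ := List.exists_mem_of_length_pos
    (hlen.symm ▸ (by positivity : 0 < r ^ 2 * n.choose ((n + 1) / 2)))
  obtain ⟨A, hA, hstr⟩ := exists_hasStrata_of_isStackOutput (m := (n + 1) / 2) (n := n) (q := r)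
    (by omega) (by omega)
    (by rw [← (hb b hbm).2.2, List.toFinset_card_of_nodup (hb b hbm).2.1, (hb b hbm).1]) hlen
    (fun c hc => ⟨(hb c hc).1, (hb c hc).2.2⟩) (by nlinarith) hout
  obtain ⟨u, hu, hstrat'⟩ := hstr.exists_stratifiedWord hr
  rw [(Finset.mem_powersetCard.1 hA).2] at hstrat'
  exact ⟨⟦u⟧, ⟨u, rfl, hstrat'⟩, out, u, rfl, hu, rfl⟩
end
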